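/- Let w be a convex metric modular on a set X, let x₀ ∈ X, let (x_n) be a sequence in the modular set X_w^*(x₀) and let x ∈ X_w^*(x₀). Then d_w^*(x_n, x) → 0 as n → ∞ if and only if w_λ(x_n, x) → 0 as n → ∞ for every λ > 0, where d_w^*(x, y) = inf{λ > 0 : w_λ(x, y) ≤ 1}. -/

import Mathlib

open ENNReal Filter Topology

/-- A convex metric modular satisfies `w L x y ≤ (l / L) * w l x y` for `0 < l ≤ L`. -/
lemma convexModular_le_ofReal_div_mul {X : Type*} {w : ℝ → X → X → ℝ≥0∞}
    (h1 : ∀ x : X, ∀ l : ℝ, 0 < l → w l x x = 0)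
    (h3 : ∀ l m : ℝ, 0 < l → 0 < m → ∀ x y z : X,
      w (l + m) x y ≤ ENNReal.ofReal (l / (l + m)) * w l x z
        + ENNReal.ofReal (m / (l + m)) * w m z y)
    {l L : ℝ} (hl : 0 < l) (hL : l ≤ L) (x y : X) :
    w L x y ≤ ENNReal.ofReal (l / L) * w l x y := by
  rcases hL.eq_or_lt with rfl | hL
  · simp [div_self hl.ne']
  · have h := h3 l (L - l) hl (sub_pos.2 hL) x y y
    rwa [h1 y _ (sub_pos.2 hL), mul_zero, add_zero, add_sub_cancel] at h

/-- In a convex metric modular, if some value `w l x y` is finite then some value is at most `1`. -/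
lemma convexModular_exists_le_one {X : Type*} {w : ℝ → X → X → ℝ≥0∞}
    (h1 : ∀ x : X, ∀ l : ℝ, 0 < l → w l x x = 0)
    (h3 : ∀ l m : ℝ, 0 < l → 0 < m → ∀ x y z : X,
      w (l + m) x y ≤ ENNReal.ofReal (l / (l + m)) * w l x z
        + ENNReal.ofReal (m / (l + m)) * w m z y)
    {l : ℝ} (hl : 0 < l) {x y : X} (hw : w l x y < ⊤) :
    ∃ L : ℝ, 0 < L ∧ w L x y ≤ 1 := by
  set c := (w l x y).toReal with hc
  have hc0 : 0 ≤ c := ENNReal.toReal_nonneg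
  have hL : 0 < l * (1 + c) := by positivity
  refine ⟨l * (1 + c), hL, ?_⟩
  refine (convexModular_le_ofReal_div_mul h1 h3 hl (by nlinarith) x y).trans ?_
  rw [← ENNReal.ofReal_toReal hw.ne, ← hc, ← ENNReal.ofReal_mul (by positivity)]
  refine ENNReal.ofReal_le_one.2 ?_
  rw [div_mul_eq_mul_div, div_le_one hL]
  nlinarith

/-- for a convex metric modular `w`, a sequence `(xₙ)` in `X_w^*(x₀)`
and `x ∈ X_w^*(x₀)`, we have `d_w^*(xₙ, x) → 0` iff `w l (xₙ) x → 0` for every `l > 0`. -/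
theorem dwstar_convergence_iff_modular_convergence {X : Type*} (w : ℝ → X → X → ℝ≥0∞)
    (h1 : ∀ x y : X, (∀ l : ℝ, 0 < l → w l x y = 0) ↔ x = y)
    (h2 : ∀ l : ℝ, 0 < l → ∀ x y : X, w l x y = w l y x)
    (h3 : ∀ l m : ℝ, 0 < l → 0 < m → ∀ x y z : X,
      w (l + m) x y ≤ ENNReal.ofReal (l / (l + m)) * w l x z
        + ENNReal.ofReal (m / (l + m)) * w m z y)
    (x₀ : X)
    (S : Set X) (hS : S = {x : X | ∃ l : ℝ, 0 < l ∧ w l x x₀ < ⊤})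
    (dws : X → X → ℝ)
    (hdws : ∀ x y : X, dws x y = sInf {l : ℝ | 0 < l ∧ w l x y ≤ 1})
    (u : ℕ → X) (hu : ∀ n, u n ∈ S) (x : X) (hx : x ∈ S) :
    Tendsto (fun n => dws (u n) x) atTop (𝓝 0) ↔
      ∀ l : ℝ, 0 < l → Tendsto (fun n => w l (u n) x) atTop (𝓝 0) := by
  have h0 : ∀ x : X, ∀ l : ℝ, 0 < l → w l x x = 0 := fun x => (h1 x x).2 rfl
  have hbdd : ∀ y : X, BddBelow {l : ℝ | 0 < l ∧ w l y x ≤ 1} := fun y => ⟨0, fun l hl => hl.1.le⟩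
  have hne : ∀ n, {l : ℝ | 0 < l ∧ w l (u n) x ≤ 1}.Nonempty := by
    intro n
    have hun := hu n
    rw [hS] at hun hx
    obtain ⟨a, ha, hwa⟩ := hun
    obtain ⟨b, hb, hwb⟩ := hx
    rw [h2 b hb] at hwb
    exact convexModular_exists_le_one h0 h3 (add_pos ha hb) <|
      (h3 a b ha hb (u n) x x₀).trans_lt <| ENNReal.add_lt_top.2
        ⟨ENNReal.mul_lt_top ENNReal.ofReal_lt_top hwa, ENNReal.mul_lt_top ENNReal.ofReal_lt_top hwb⟩
  constructor
  · intro h l hl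
    rw [ENNReal.tendsto_nhds_zero]
    intro ε hε
    have hfin : min 1 ε ≠ ⊤ := (min_lt_of_left_lt ENNReal.one_lt_top).ne
    have hδ : 0 < (min 1 ε).toReal := ENNReal.toReal_pos (lt_min one_pos hε).ne' hfin
    have hδ1 : (min 1 ε).toReal ≤ 1 := ENNReal.toReal_le_of_le_ofReal zero_le_one (by simp)
    filter_upwards [h.eventually_lt_const (mul_pos hδ hl)] with n hn
    rw [hdws] at hn
    obtain ⟨m, ⟨hm, hwm⟩, hml⟩ := (csInf_lt_iff (hbdd _) (hne n)).1 hn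
    calc w l (u n) x ≤ ENNReal.ofReal (m / l) * w m (u n) x :=
          convexModular_le_ofReal_div_mul h0 h3 hm (by nlinarith) _ _
      _ ≤ ENNReal.ofReal (m / l) := mul_le_of_le_one_right' hwm
      _ ≤ ENNReal.ofReal (min 1 ε).toReal :=
          ENNReal.ofReal_le_ofReal ((div_le_iff₀ hl).2 hml.le)
      _ = min 1 ε := ENNReal.ofReal_toReal hfin
      _ ≤ ε := min_le_right _ _
  · intro h
    have hnonneg : ∀ n, 0 ≤ dws (u n) x := fun n => by
      rw [hdws]
      exact Real.sInf_nonneg fun l hl => hl.1.le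
    refine tendsto_order.2 ⟨fun a ha => .of_forall fun n => ha.trans_le (hnonneg n), ?_⟩
    intro ε hε
    filter_upwards [(h (ε / 2) (half_pos hε)).eventually_lt_const one_pos] with n hn
    rw [hdws]
    exact (csInf_le (hbdd _) ⟨half_pos hε, hn.le⟩).trans_lt (half_lt_self hε)
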